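/- Let c ∈ ℭ_+(N), P ∈ 𝔓_+(N), and let Q̂ be the unique minimizer of J_P over 𝔓_+(N). Then the problem of maximizing the generalized entropy I_P(Φ) := (1/(2N)) Σ_{j=-N+1}^{N} P(ζ_j) log Φ(ζ_j) over all functions Φ : {ζ_{-N+1}, …, ζ_N} → (0,∞) satisfying the moment conditions for c has a unique solution, namely Φ̂(ζ_j) = P(ζ_j)/Q̂(ζ_j). -/

import Mathlib

open Complex Finset Filter Topology

noncomputable section

/-- Coefficient space for symmetric trigonometric polynomials of degree `n`:
`(p₀, (p₁, …, pₙ))` with `p₀` real and `p₋ₖ = conj pₖ` implicit. Also used for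
covariance data `c = (c₀, (c₁, …, cₙ))`. -/
abbrev Coef (n : ℕ) := ℝ × (Fin n → ℂ)

/-- The `2N`-th roots of unity `ζ_j = exp(iπj/N)`. -/
def zet (N : ℕ) (j : ℤ) : ℂ := Complex.exp (Real.pi * Complex.I * j / N)

/-- The index set `j = -N+1, …, N`. -/
def idxs (N : ℕ) : Finset ℤ := Finset.Icc (-(N : ℤ) + 1) N

/-- Evaluation of `P(z) = Σ_{k=-n}^n p_k z^{-k}` (with `p₋ₖ = conj pₖ`). -/
def evalC {n : ℕ} (p : Coef n) (z : ℂ) : ℂ :=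
  (p.1 : ℂ) + ∑ k : Fin n,
    (p.2 k * z⁻¹ ^ ((k : ℕ) + 1) + (starRingEnd ℂ) (p.2 k) * z ^ ((k : ℕ) + 1))

/-- Real value of the symmetric trigonometric polynomial on the unit circle. -/
def evalR {n : ℕ} (p : Coef n) (z : ℂ) : ℝ := (evalC p z).re

/-- The open cone `𝔓₊(N)`. -/
def Pplus (n N : ℕ) : Set (Coef n) := {p | ∀ j ∈ idxs N, 0 < evalR p (zet N j)}

/-- The closure of `𝔓₊(N)`: `P(ζ_j) ≥ 0` for all `j`. -/
def Pnn (n N : ℕ) : Set (Coef n) := {p | ∀ j ∈ idxs N, 0 ≤ evalR p (zet N j)}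

/-- The cone `𝔓₊` of trigonometric polynomials positive on the whole circle. -/
def PplusC (n : ℕ) : Set (Coef n) :=
  {p | ∀ θ ∈ Set.Icc (-Real.pi) Real.pi, 0 < evalR p (Complex.exp (θ * Complex.I))}

/-- The closure of `𝔓₊`: nonnegative on the whole circle. -/
def PnnC (n : ℕ) : Set (Coef n) :=
  {p | ∀ θ ∈ Set.Icc (-Real.pi) Real.pi, 0 ≤ evalR p (Complex.exp (θ * Complex.I))}

/-- The pairing `⟨C,P⟩ = Σ_{k=-n}^n c_k conj(p_k)` (a real number). -/
def pairCP {n : ℕ} (c p : Coef n) : ℝ :=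
  c.1 * p.1 + ∑ k : Fin n, 2 * (c.2 k * (starRingEnd ℂ) (p.2 k)).re

/-- The open dual cone `ℭ₊(N)`. -/
def Cplus (n N : ℕ) : Set (Coef n) := {c | ∀ p ∈ Pnn n N, p ≠ 0 → 0 < pairCP c p}

/-- The open dual cone `ℭ₊`. -/
def CplusC (n : ℕ) : Set (Coef n) := {c | ∀ p ∈ PnnC n, p ≠ 0 → 0 < pairCP c p}

/-- The discrete moment `(1/(2N)) Σ_j ζ_j^k Φ(ζ_j)`. -/
def dmom (N : ℕ) (Φ : ℤ → ℝ) (k : ℤ) : ℂ :=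
  (1 / (2 * (N : ℂ))) * ∑ j ∈ idxs N, zet N j ^ k * (Φ j : ℂ)

/-- `Φ` (a function of the index `j`) satisfies the moment conditions for `c`. -/
def MomCond {n : ℕ} (N : ℕ) (c : Coef n) (Φ : ℤ → ℝ) : Prop :=
  dmom N Φ 0 = (c.1 : ℂ) ∧ ∀ k : Fin n, dmom N Φ ((k : ℕ) + 1) = c.2 k

/-- The function `j ↦ P(ζ_j)/Q(ζ_j)`. -/
def phiOf {n : ℕ} (N : ℕ) (P Q : Coef n) : ℤ → ℝ :=
  fun j => evalR P (zet N j) / evalR Q (zet N j)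

/-- The dual functional `J_P(Q) = ⟨C,Q⟩ − (1/(2N)) Σ_j P(ζ_j) log Q(ζ_j)`. -/
def JP {n : ℕ} (N : ℕ) (c P Q : Coef n) : ℝ :=
  pairCP c Q - (1 / (2 * (N : ℝ))) * ∑ j ∈ idxs N,
    evalR P (zet N j) * Real.log (evalR Q (zet N j))

/-- The moment map `F^P`, with components `F^P_k(Q) = (1/(2N)) Σ_j ζ_j^k P(ζ_j)/Q(ζ_j)`. -/
def Fmap {n : ℕ} (N : ℕ) (P Q : Coef n) : Coef n :=
  ((dmom N (phiOf N P Q) 0).re, fun k => dmom N (phiOf N P Q) ((k : ℕ) + 1))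

/-- The generalized entropy `I_P(Φ) = (1/(2N)) Σ_j P(ζ_j) log Φ(ζ_j)`. -/
def entP {n : ℕ} (N : ℕ) (P : Coef n) (Φ : ℤ → ℝ) : ℝ :=
  (1 / (2 * (N : ℝ))) * ∑ j ∈ idxs N, evalR P (zet N j) * Real.log (Φ j)

/-- `Φ` is feasible: positive on the discrete circle and matching the moments of `c`. -/
def Feas {n : ℕ} (N : ℕ) (c : Coef n) (Φ : ℤ → ℝ) : Prop :=
  (∀ j ∈ idxs N, 0 < Φ j) ∧ MomCond N c Φ

/-- The vector of moments of `Φ`, as covariance data. -/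
def momentVec (n N : ℕ) (Φ : ℤ → ℝ) : Coef n :=
  ((dmom N Φ 0).re, fun k => dmom N Φ ((k : ℕ) + 1))

lemma zet_inv (N : ℕ) (j : ℤ) : (zet N j)⁻¹ = (starRingEnd ℂ) (zet N j) := by
  unfold zet
  rw [← Complex.exp_neg, ← Complex.exp_conj]
  congr 1
  simp
  ring

lemma evalR_zet {n : ℕ} (N : ℕ) (q : Coef n) (j : ℤ) :
    evalR q (zet N j) =
      q.1 + ∑ k : Fin n, 2 * (zet N j ^ ((k : ℕ) + 1) * (starRingEnd ℂ) (q.2 k)).re := by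
  unfold evalR evalC
  rw [Complex.add_re, Complex.ofReal_re, Complex.re_sum]
  congr 1
  refine Finset.sum_congr rfl fun k _ => ?_
  rw [zet_inv, ← map_pow]
  simp only [Complex.add_re, Complex.mul_re, Complex.conj_re, Complex.conj_im]
  ring

lemma dmom_mul_re (N : ℕ) (Φ : ℤ → ℝ) (k : ℤ) (w : ℂ) :
    (dmom N Φ k * w).re =
      (1 / (2 * (N : ℝ))) * ∑ j ∈ idxs N, Φ j * (zet N j ^ k * w).re := by
  have h : dmom N Φ k * w = ((1 / (2 * (N : ℝ)) : ℝ) : ℂ) *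
      ∑ j ∈ idxs N, (Φ j : ℂ) * (zet N j ^ k * w) := by
    unfold dmom
    push_cast
    rw [mul_assoc, Finset.sum_mul]
    congr 1
    exact Finset.sum_congr rfl fun j _ => by ring
  rw [h, Complex.re_ofReal_mul, Complex.re_sum]
  simp only [Complex.re_ofReal_mul]

lemma dmom_zero (N : ℕ) (Φ : ℤ → ℝ) :
    dmom N Φ 0 = (((1 / (2 * (N : ℝ))) * ∑ j ∈ idxs N, Φ j : ℝ) : ℂ) := by
  unfold dmom
  simp

/-- Pairing the moments of `Φ` with `q` is integrating `Φ` against `q`. -/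
lemma pairCP_momentVec {n : ℕ} (N : ℕ) (Φ : ℤ → ℝ) (q : Coef n) :
    pairCP (momentVec n N Φ) q =
      (1 / (2 * (N : ℝ))) * ∑ j ∈ idxs N, Φ j * evalR q (zet N j) := by
  unfold pairCP momentVec
  simp only [dmom_mul_re, evalR_zet, dmom_zero, Complex.ofReal_re, mul_add,
    Finset.sum_add_distrib]
  congr 1
  · rw [mul_assoc, Finset.sum_mul]
  · simp only [Finset.mul_sum]
    rw [Finset.sum_comm]
    refine Finset.sum_congr rfl fun j _ => Finset.sum_congr rfl fun k _ => ?_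
    have : zet N j ^ (((k : ℕ) : ℤ) + 1) = zet N j ^ ((k : ℕ) + 1) := by
      exact_mod_cast zpow_natCast (zet N j) ((k : ℕ) + 1)
    rw [this]
    ring

lemma momCond_iff {n : ℕ} (N : ℕ) (c : Coef n) (Φ : ℤ → ℝ) :
    MomCond N c Φ ↔ momentVec n N Φ = c := by
  unfold MomCond momentVec
  rw [Prod.ext_iff, funext_iff, dmom_zero, Complex.ofReal_inj, Complex.ofReal_re]

lemma evalR_add_smul {n : ℕ} (p q : Coef n) (t : ℝ) (N : ℕ) (j : ℤ) :
    evalR (p + t • q) (zet N j) = evalR p (zet N j) + t * evalR q (zet N j) := by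
  simp only [evalR_zet, mul_add, Finset.mul_sum, Prod.fst_add, Prod.smul_fst, Prod.snd_add,
    Prod.smul_snd, Pi.add_apply, Pi.smul_apply, smul_eq_mul, map_add, Complex.add_re,
    Complex.real_smul, map_mul, Complex.conj_ofReal, Finset.sum_add_distrib]
  have : ∀ k : Fin n, 2 * (zet N j ^ ((k : ℕ) + 1) * ((t : ℂ) * (starRingEnd ℂ) (q.2 k))).re =
      t * (2 * (zet N j ^ ((k : ℕ) + 1) * (starRingEnd ℂ) (q.2 k)).re) := fun k => by
    rw [mul_left_comm, Complex.re_ofReal_mul]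
    ring
  simp only [this]
  ring

lemma pairCP_add_smul {n : ℕ} (c p q : Coef n) (t : ℝ) :
    pairCP c (p + t • q) = pairCP c p + t * pairCP c q := by
  unfold pairCP
  simp only [mul_add, Finset.mul_sum, Prod.fst_add, Prod.smul_fst, Prod.snd_add,
    Prod.smul_snd, Pi.add_apply, Pi.smul_apply, smul_eq_mul, map_add, Complex.add_re,
    Complex.real_smul, map_mul, Complex.conj_ofReal, Finset.sum_add_distrib]
  have : ∀ k : Fin n, 2 * (c.2 k * ((t : ℂ) * (starRingEnd ℂ) (q.2 k))).re =
      t * (2 * (c.2 k * (starRingEnd ℂ) (q.2 k)).re) := fun k => by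
    rw [mul_left_comm, Complex.re_ofReal_mul]
    ring
  simp only [this]
  ring

lemma pairCP_sub_left {n : ℕ} (c d q : Coef n) :
    pairCP (c - d) q = pairCP c q - pairCP d q := by
  unfold pairCP
  simp only [Prod.fst_sub, Prod.snd_sub, Pi.sub_apply, sub_mul, Complex.sub_re, mul_sub,
    Finset.sum_sub_distrib]
  ring

lemma eq_zero_of_pairCP_self {n : ℕ} (d : Coef n) (h : pairCP d d = 0) : d = 0 := by
  unfold pairCP at h
  simp only [Complex.mul_conj, Complex.ofReal_re] at h
  have h2 : ∀ k ∈ (Finset.univ : Finset (Fin n)), 0 ≤ 2 * Complex.normSq (d.2 k) :=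
    fun k _ => mul_nonneg zero_le_two (Complex.normSq_nonneg _)
  have hs := Finset.sum_nonneg h2
  have h1 : d.1 = 0 := by nlinarith [mul_self_nonneg d.1]
  have h3 : ∑ k : Fin n, 2 * Complex.normSq (d.2 k) = 0 := by rw [h1] at h; linarith
  rw [Finset.sum_eq_zero_iff_of_nonneg h2] at h3
  refine Prod.ext h1 (funext fun k => ?_)
  have := h3 k (Finset.mem_univ k)
  exact Complex.normSq_eq_zero.mp (by linarith)

lemma eventually_mem_Pplus {n N : ℕ} {Q : Coef n} (hQ : Q ∈ Pplus n N) (q : Coef n) :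
    ∀ᶠ t : ℝ in 𝓝 0, Q + t • q ∈ Pplus n N := by
  refine (Filter.eventually_all_finset (idxs N)).mpr fun j hj => ?_
  simp only [evalR_add_smul]
  have hcont : Continuous fun t : ℝ => evalR Q (zet N j) + t * evalR q (zet N j) := by fun_prop
  refine hcont.continuousAt.eventually_mem (isOpen_Ioi.mem_nhds ?_)
  simpa using hQ j hj

lemma hasDerivAt_JP {n N : ℕ} (c P : Coef n) {Q : Coef n} (hQ : Q ∈ Pplus n N) (q : Coef n) :
    HasDerivAt (fun t : ℝ => JP N c P (Q + t • q))
      (pairCP (c - momentVec n N (phiOf N P Q)) q) 0 := by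
  rw [pairCP_sub_left, pairCP_momentVec]
  simp only [JP, evalR_add_smul, pairCP_add_smul]
  refine HasDerivAt.sub ?_ (HasDerivAt.const_mul _ (HasDerivAt.fun_sum fun j hj => ?_))
  · simpa using ((hasDerivAt_id (0 : ℝ)).mul_const (pairCP c q)).const_add (pairCP c Q)
  · have hlin : HasDerivAt (fun t : ℝ => evalR Q (zet N j) + t * evalR q (zet N j))
        (evalR q (zet N j)) 0 := by
      simpa using ((hasDerivAt_id (0 : ℝ)).mul_const (evalR q (zet N j))).const_add
        (evalR Q (zet N j))
    have := (hlin.log (by simpa using (hQ j hj).ne')).const_mul (evalR P (zet N j))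
    refine this.congr_deriv ?_
    simp [phiOf]
    ring

/-- A minimizer of the dual functional matches the moments. -/
lemma momentVec_phiOf_of_isMin {n N : ℕ} {c P Q : Coef n} (hQ : Q ∈ Pplus n N)
    (hmin : ∀ Q' ∈ Pplus n N, JP N c P Q ≤ JP N c P Q') :
    momentVec n N (phiOf N P Q) = c := by
  set d := c - momentVec n N (phiOf N P Q) with hd
  have hloc : IsLocalMin (fun t : ℝ => JP N c P (Q + t • d)) 0 := by
    filter_upwards [eventually_mem_Pplus hQ d] with t ht
    simpa using hmin _ ht
  have h := eq_zero_of_pairCP_self d (hloc.hasDerivAt_eq_zero (hasDerivAt_JP c P hQ d))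
  exact (sub_eq_zero.mp (hd.symm.trans h)).symm

/-- The tangent-line inequality for the logarithm at `p / q`, with its equality case. -/
lemma mul_log_sub_le {p q x : ℝ} (hp : 0 < p) (hq : 0 < q) (hx : 0 < x) :
    p * Real.log x - p * Real.log (p / q) ≤ x * q - p ∧
      (p * Real.log x - p * Real.log (p / q) = x * q - p → x = p / q) := by
  have hy : 0 < x * q / p := by positivity
  have hlog : Real.log x - Real.log (p / q) = Real.log (x * q / p) := by
    rw [← Real.log_div hx.ne' (by positivity)]
    congr 1
    field_simp
  have hr : x * q - p = p * (x * q / p - 1) := by field_simp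
  rw [← mul_sub, hlog, hr]
  refine ⟨mul_le_mul_of_nonneg_left (Real.log_le_sub_one_of_pos hy) hp.le, fun h => ?_⟩
  have h1 := mul_left_cancel₀ hp.ne' h
  by_contra hne
  refine (Real.log_lt_sub_one_of_pos hy fun h2 => hne ?_).ne h1
  rw [div_eq_one_iff_eq hp.ne'] at h2
  rw [← h2]
  field_simp

/-- The primal problem of maximizing the generalized entropy `I_P` over
positive `Φ` satisfying the moment conditions has the unique solution `Φ̂ = P/Q̂`, where `Q̂`
is the unique minimizer of `J_P` over `𝔓₊(N)`. -/
theorem primal_problem_unique_solution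
    (n N : ℕ) (hn : 1 ≤ n) (hnN : n < N)
    (c : Coef n) (hc : c ∈ Cplus n N) (P : Coef n) (hP : P ∈ Pplus n N)
    (Qh : Coef n) (hQh : Qh ∈ Pplus n N)
    (hmin : ∀ Q ∈ Pplus n N, JP N c P Qh ≤ JP N c P Q)
    (huniq : ∀ Q ∈ Pplus n N, (∀ Q' ∈ Pplus n N, JP N c P Q ≤ JP N c P Q') → Q = Qh) :
    Feas N c (phiOf N P Qh) ∧
    (∀ Φ : ℤ → ℝ, Feas N c Φ → entP N P Φ ≤ entP N P (phiOf N P Qh)) ∧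
    (∀ Φ : ℤ → ℝ, Feas N c Φ → entP N P Φ = entP N P (phiOf N P Qh) →
      ∀ j ∈ idxs N, Φ j = phiOf N P Qh j) := by
  have hmom := momentVec_phiOf_of_isMin hQh hmin
  have hN : (0 : ℝ) < 1 / (2 * (N : ℝ)) := by
    have : (0 : ℝ) < N := by exact_mod_cast (Nat.zero_le n).trans_lt hnN
    positivity
  have hfeas : Feas N c (phiOf N P Qh) :=
    ⟨fun j hj => div_pos (hP j hj) (hQh j hj), (momCond_iff N c _).mpr hmom⟩
  have hgap : ∀ Φ : ℤ → ℝ, Feas N c Φ →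
      ∑ j ∈ idxs N, (Φ j * evalR Qh (zet N j) - evalR P (zet N j)) = 0 := by
    intro Φ hΦ
    have h := (pairCP_momentVec N Φ Qh).symm.trans
      ((congrArg (pairCP · Qh) (((momCond_iff N c Φ).mp hΦ.2).trans hmom.symm)).trans
        (pairCP_momentVec N (phiOf N P Qh) Qh))
    rw [Finset.sum_sub_distrib, mul_left_cancel₀ hN.ne' h, sub_eq_zero]
    exact Finset.sum_congr rfl fun j hj => div_mul_cancel₀ _ (hQh j hj).ne'
  have hent : ∀ Φ : ℤ → ℝ, entP N P Φ - entP N P (phiOf N P Qh) = (1 / (2 * (N : ℝ))) *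
      ∑ j ∈ idxs N, (evalR P (zet N j) * Real.log (Φ j) -
        evalR P (zet N j) * Real.log (phiOf N P Qh j)) := by
    intro Φ
    rw [Finset.sum_sub_distrib, mul_sub]
    rfl
  have hle : ∀ Φ : ℤ → ℝ, Feas N c Φ → ∀ j ∈ idxs N,
      evalR P (zet N j) * Real.log (Φ j) - evalR P (zet N j) * Real.log (phiOf N P Qh j) ≤
        Φ j * evalR Qh (zet N j) - evalR P (zet N j) := fun Φ hΦ j hj =>
    (mul_log_sub_le (hP j hj) (hQh j hj) (hΦ.1 j hj)).1
  refine ⟨hfeas, fun Φ hΦ => ?_, fun Φ hΦ heq j hj => ?_⟩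
  · have hs := (Finset.sum_le_sum (hle Φ hΦ)).trans (hgap Φ hΦ).le
    have := hent Φ ▸ mul_nonpos_of_nonneg_of_nonpos hN.le hs
    linarith
  · have h0 := (mul_eq_zero.mp ((hent Φ).symm.trans (sub_eq_zero.mpr heq))).resolve_left hN.ne'
    have hall := (Finset.sum_eq_sum_iff_of_le (hle Φ hΦ)).mp (h0.trans (hgap Φ hΦ).symm)
    exact (mul_log_sub_le (hP j hj) (hQh j hj) (hΦ.1 j hj)).2 (hall j hj)
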